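/- Let Q = [0,l]² with l > 0, let u be a C² function on Q, and let x⁰ ∈ Q. Then ∫_Q u(x)² dx − 2 l² u(x⁰)² ≤ 8 l² ∫_Q (|∂₁u|² + |∂₂u|²) dx + 4 l⁴ ∫_Q (∂₁∂₂u)² dx. -/

import Mathlib

open MeasureTheory Real

/-- First partial derivative of a function on `ℝ²`. -/
noncomputable def pd1 (f : ℝ × ℝ → ℝ) (p : ℝ × ℝ) : ℝ :=
  deriv (fun s => f (s, p.2)) p.1

/-- Second partial derivative of a function on `ℝ²`. -/
noncomputable def pd2 (f : ℝ × ℝ → ℝ) (p : ℝ × ℝ) : ℝ :=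
  deriv (fun s => f (p.1, s)) p.2

theorem pd1_eq_fderiv {f : ℝ × ℝ → ℝ} (hf : Differentiable ℝ f) :
    pd1 f = fun p => fderiv ℝ f p (1, 0) := by
  funext p
  have h : HasDerivAt (fun s : ℝ => (s, p.2)) ((1 : ℝ), (0 : ℝ)) p.1 :=
    (hasDerivAt_id p.1).prodMk (hasDerivAt_const p.1 p.2)
  exact ((hf (p.1, p.2)).hasFDerivAt.comp_hasDerivAt p.1 h).deriv

theorem pd2_eq_fderiv {f : ℝ × ℝ → ℝ} (hf : Differentiable ℝ f) :
    pd2 f = fun p => fderiv ℝ f p (0, 1) := by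
  funext p
  have h : HasDerivAt (fun s : ℝ => (p.1, s)) ((0 : ℝ), (1 : ℝ)) p.2 :=
    (hasDerivAt_const p.2 p.1).prodMk (hasDerivAt_id p.2)
  exact ((hf (p.1, p.2)).hasFDerivAt.comp_hasDerivAt p.2 h).deriv

theorem ContDiff.continuous_pd1 {f : ℝ × ℝ → ℝ} (hf : ContDiff ℝ 1 f) : Continuous (pd1 f) := by
  rw [pd1_eq_fderiv (hf.differentiable one_ne_zero)]
  exact (hf.continuous_fderiv one_ne_zero).clm_apply continuous_const

theorem ContDiff.contDiff_pd2 {f : ℝ × ℝ → ℝ} (hf : ContDiff ℝ 2 f) : ContDiff ℝ 1 (pd2 f) := by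
  rw [pd2_eq_fderiv (hf.differentiable two_ne_zero)]
  exact (hf.fderiv_right (m := 1) (by norm_num)).clm_apply contDiff_const

/-- Cauchy–Schwarz bound for the increments of a `C¹` function on `[0,l]`. -/
theorem sq_sub_le_mul_setIntegral_deriv_sq {f : ℝ → ℝ} (hf : ContDiff ℝ 1 f) {l a x : ℝ}
    (ha : a ∈ Set.Icc 0 l) (hx : x ∈ Set.Icc 0 l) :
    (f x - f a) ^ 2 ≤ l * ∫ s in Set.Icc 0 l, (deriv f s) ^ 2 := by
  wlog hax : a ≤ x generalizing a x
  · rw [← neg_sub, neg_sq]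
    exact this hx ha (le_of_not_ge hax)
  obtain ⟨ha0, hal⟩ := ha
  obtain ⟨hx0, hxl⟩ := hx
  have hc : Continuous (deriv f) := hf.continuous_deriv_one
  have hftc : ∫ s in a..x, deriv f s = f x - f a :=
    intervalIntegral.integral_deriv_eq_sub
      (fun y _ => hf.differentiable one_ne_zero y) (hc.intervalIntegrable a x)
  have hnonneg : 0 ≤ ∫ s in a..x, (l * deriv f s - (f x - f a)) ^ 2 :=
    intervalIntegral.integral_nonneg hax fun s _ => sq_nonneg _
  have hexpand : ∫ s in a..x, (l * deriv f s - (f x - f a)) ^ 2 =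
      l ^ 2 * (∫ s in a..x, (deriv f s) ^ 2) - 2 * l * (f x - f a) * (f x - f a)
        + (x - a) * (f x - f a) ^ 2 := by
    have h : ∀ s, (l * deriv f s - (f x - f a)) ^ 2 =
        l ^ 2 * (deriv f s) ^ 2 - 2 * l * (f x - f a) * deriv f s + (f x - f a) ^ 2 := by
      intro s; ring
    simp_rw [h]
    rw [intervalIntegral.integral_add, intervalIntegral.integral_sub,
      intervalIntegral.integral_const_mul, intervalIntegral.integral_const_mul, hftc,
      intervalIntegral.integral_const, smul_eq_mul]
    all_goals exact Continuous.intervalIntegrable (by fun_prop) _ _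
  have hmono : ∫ s in a..x, (deriv f s) ^ 2 ≤ ∫ s in Set.Icc 0 l, (deriv f s) ^ 2 := by
    rw [intervalIntegral.integral_of_le hax]
    refine setIntegral_mono_set (hc.pow 2).integrableOn_Icc
      (Filter.Eventually.of_forall fun s => sq_nonneg _) (LE.le.eventuallyLE ?_)
    exact fun s hs => ⟨ha0.trans hs.1.le, hs.2.trans hxl⟩
  rcases (ha0.trans hal).eq_or_lt with rfl | hl
  · rw [le_antisymm hxl hx0, le_antisymm hal ha0]
    simp
  rw [hexpand] at hnonneg
  refine le_of_mul_le_mul_left ?_ hl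
  nlinarith [mul_le_mul_of_nonneg_left hmono (sq_nonneg l),
    mul_nonneg (show 0 ≤ l - (x - a) by linarith) (sq_nonneg (f x - f a))]

theorem Continuous.integrable_prod_restrict_Icc {g : ℝ × ℝ → ℝ} (hg : Continuous g) (l : ℝ) :
    Integrable g ((volume.restrict (Set.Icc 0 l)).prod (volume.restrict (Set.Icc 0 l))) := by
  rw [Measure.prod_restrict]
  exact hg.continuousOn.integrableOn_compact (isCompact_Icc.prod isCompact_Icc)

theorem integral_prod_restrict_Icc_snd {l : ℝ} (hl : 0 ≤ l) (h : ℝ → ℝ) :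
    ∫ p : ℝ × ℝ, h p.2 ∂((volume.restrict (Set.Icc 0 l)).prod (volume.restrict (Set.Icc 0 l))) =
      l * ∫ y in Set.Icc 0 l, h y := by
  rw [integral_fun_snd]
  simp [hl]

theorem integral_prod_restrict_Icc_slice {g : ℝ × ℝ → ℝ} (hg : Continuous g) {l : ℝ}
    (hl : 0 ≤ l) :
    ∫ p : ℝ × ℝ, (∫ s in Set.Icc 0 l, g (s, p.2))
        ∂((volume.restrict (Set.Icc 0 l)).prod (volume.restrict (Set.Icc 0 l))) =
      l * ∫ p, g p ∂((volume.restrict (Set.Icc 0 l)).prod (volume.restrict (Set.Icc 0 l))) := by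
  rw [integral_prod_restrict_Icc_snd hl fun y => ∫ s in Set.Icc 0 l, g (s, y),
    integral_prod_symm _ (hg.integrable_prod_restrict_Icc l)]

theorem integrable_prod_restrict_Icc_slice {g : ℝ × ℝ → ℝ} (hg : Continuous g) (l : ℝ) :
    Integrable (fun p : ℝ × ℝ => ∫ s in Set.Icc 0 l, g (s, p.2))
      ((volume.restrict (Set.Icc 0 l)).prod (volume.restrict (Set.Icc 0 l))) :=
  (hg.integrable_prod_restrict_Icc l).integral_prod_right.comp_snd _

/-- Trace inequality: the `L²` norm of a `C¹` function on a vertical segment of the square. -/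
theorem mul_setIntegral_slice_sq_le {v : ℝ × ℝ → ℝ} (hv : ContDiff ℝ 1 v) {l a : ℝ}
    (ha : a ∈ Set.Icc 0 l) :
    l * ∫ t in Set.Icc 0 l, (v (a, t)) ^ 2 ≤
      3 * (∫ p in Set.Icc 0 l ×ˢ Set.Icc 0 l, (v p) ^ 2) +
        3 / 2 * l ^ 2 * ∫ p in Set.Icc 0 l ×ˢ Set.Icc 0 l, (pd1 v p) ^ 2 := by
  have hl : 0 ≤ l := ha.1.trans ha.2
  have hc := hv.continuous
  have hc1 := (hv.continuous_pd1).pow 2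
  rw [← integral_prod_restrict_Icc_snd hl fun t => (v (a, t)) ^ 2, Measure.volume_eq_prod,
    ← Measure.prod_restrict]
  have hi := ((hc.pow 2).integrable_prod_restrict_Icc l).const_mul 3
  have hi1 := (integrable_prod_restrict_Icc_slice hc1 l).const_mul (3 / 2 * l)
  calc _ ≤ _ := integral_mono_ae
        (Continuous.integrable_prod_restrict_Icc (by fun_prop) l) (hi.add hi1) ?_
    _ = _ := by
      rw [integral_add' hi hi1, integral_const_mul, integral_const_mul,
        integral_prod_restrict_Icc_slice hc1 hl]
      simp only [Pi.pow_apply]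
      ring
  rw [Measure.prod_restrict]
  filter_upwards [ae_restrict_mem (measurableSet_Icc.prod measurableSet_Icc)] with p hp
  have h := sq_sub_le_mul_setIntegral_deriv_sq (f := fun s => v (s, p.2))
    (by fun_prop) ha hp.1
  simp only [Pi.add_apply, pd1, Pi.pow_apply, Prod.mk.eta] at h ⊢
  nlinarith [sq_nonneg (3 * v p - v (a, p.2))]

/-- Pointwise estimate on a square `Q = [0,l]²`: for a `C²` function `u`
and any `x⁰ ∈ Q`,
`∫_Q u² − 2 l² u(x⁰)² ≤ 8 l² ∫_Q |∇u|² + 4 l⁴ ∫_Q (∂₁∂₂u)²`. -/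
theorem square_node_estimate
    (l : ℝ) (hl : 0 < l)
    (u : ℝ × ℝ → ℝ) (hu : ContDiff ℝ 2 u)
    (x0 : ℝ × ℝ) (hx0 : x0 ∈ Set.Icc (0 : ℝ) l ×ˢ Set.Icc (0 : ℝ) l) :
    (∫ p in Set.Icc (0 : ℝ) l ×ˢ Set.Icc (0 : ℝ) l, (u p) ^ 2) - 2 * l ^ 2 * (u x0) ^ 2 ≤
      8 * l ^ 2 * (∫ p in Set.Icc (0 : ℝ) l ×ˢ Set.Icc (0 : ℝ) l,
          ((pd1 u p) ^ 2 + (pd2 u p) ^ 2)) +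
      4 * l ^ 4 * ∫ p in Set.Icc (0 : ℝ) l ×ˢ Set.Icc (0 : ℝ) l,
          (pd1 (pd2 u) p) ^ 2 := by
  obtain ⟨ha, hb⟩ := hx0
  have hc := hu.continuous
  have hu1 : ContDiff ℝ 1 u := hu.of_le one_le_two
  have hv := hu.contDiff_pd2
  have hvc := hv.continuous
  have hc1 := hu1.continuous_pd1.pow 2
  have htrace := mul_setIntegral_slice_sq_le hv ha
  set T := ∫ t in Set.Icc 0 l, (pd2 u (x0.1, t)) ^ 2 with hT
  have hpt : ∀ p ∈ Set.Icc (0 : ℝ) l ×ˢ Set.Icc (0 : ℝ) l, (u p) ^ 2 ≤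
      8 * l * (∫ s in Set.Icc 0 l, (pd1 u (s, p.2)) ^ 2) +
        (2 * (u x0) ^ 2 + 8 / 3 * l * T) := by
    intro p hp
    have h1 := sq_sub_le_mul_setIntegral_deriv_sq (f := fun s => u (s, p.2))
      (by fun_prop) ha hp.1
    have h2 := sq_sub_le_mul_setIntegral_deriv_sq (f := fun t => u (x0.1, t))
      (by fun_prop) hb hp.2
    simp only [pd1, pd2, hT, Prod.mk.eta] at h1 h2 ⊢
    nlinarith [sq_nonneg (u p - 2 * u x0),
      sq_nonneg (3 * (u p - u (x0.1, p.2)) - (u (x0.1, p.2) - u x0))]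
  have hi1 := (integrable_prod_restrict_Icc_slice hc1 l).const_mul (8 * l)
  have hi0 : Integrable (fun _ : ℝ × ℝ => 2 * (u x0) ^ 2 + 8 / 3 * l * T)
      ((volume.restrict (Set.Icc 0 l)).prod (volume.restrict (Set.Icc 0 l))) :=
    integrable_const _
  have hmain : ∫ p in Set.Icc (0 : ℝ) l ×ˢ Set.Icc (0 : ℝ) l, (u p) ^ 2 ≤
      8 * l ^ 2 * (∫ p in Set.Icc (0 : ℝ) l ×ˢ Set.Icc (0 : ℝ) l, (pd1 u p) ^ 2) +
        l ^ 2 * (2 * (u x0) ^ 2 + 8 / 3 * l * T) := by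
    rw [Measure.volume_eq_prod, ← Measure.prod_restrict]
    calc _ ≤ _ := integral_mono_ae ((hc.pow 2).integrable_prod_restrict_Icc l) (hi1.add hi0) ?_
      _ = _ := by
        rw [integral_add' hi1 hi0, integral_const_mul, integral_prod_restrict_Icc_slice hc1 hl.le,
          integral_prod_restrict_Icc_snd hl.le fun _ => 2 * (u x0) ^ 2 + 8 / 3 * l * T]
        simp [hl.le]
        ring
    rw [Measure.prod_restrict]
    filter_upwards [ae_restrict_mem (measurableSet_Icc.prod measurableSet_Icc)] with p hp
    exact hpt p hp
  have hsplit : ∫ p in Set.Icc (0 : ℝ) l ×ˢ Set.Icc (0 : ℝ) l,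
      ((pd1 u p) ^ 2 + (pd2 u p) ^ 2) =
      (∫ p in Set.Icc (0 : ℝ) l ×ˢ Set.Icc (0 : ℝ) l, (pd1 u p) ^ 2) +
        ∫ p in Set.Icc (0 : ℝ) l ×ˢ Set.Icc (0 : ℝ) l, (pd2 u p) ^ 2 := by
    have hQ := (isCompact_Icc (a := (0 : ℝ)) (b := l)).prod (isCompact_Icc (a := (0 : ℝ)) (b := l))
    exact integral_add (hc1.continuousOn.integrableOn_compact hQ)
      ((hvc.pow 2).continuousOn.integrableOn_compact hQ)
  rw [hsplit]
  nlinarith [mul_le_mul_of_nonneg_left htrace (sq_nonneg l)]
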